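/- Let β be the smallest real root of the polynomial x⁶ − 3x⁵ − 7x⁴ + 21x³ + 13x² − 35x − 4. Any two connected 3-regular finite simple graphs whose smallest adjacency eigenvalue equals β are isomorphic; that is, up to isomorphism there is a unique connected 3-regular graph with smallest eigenvalue β. -/

import Mathlib

open SimpleGraph Filter

attribute [local instance] Classical.propDecidable

lemma adjMatrix_isHermitian {V : Type} [Fintype V] [DecidableEq V] (G : SimpleGraph V)
    [DecidableRel G.Adj] : (G.adjMatrix ℝ).IsHermitian := by
  rw [Matrix.IsHermitian, Matrix.conjTranspose_eq_transpose_of_trivial]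
  exact G.isSymm_adjMatrix

/-- The smallest eigenvalue of the (real) adjacency matrix of a finite simple graph. -/
noncomputable def lambdaMin {V : Type} [Fintype V] (G : SimpleGraph V) : ℝ :=
  ⨅ i : V, (adjMatrix_isHermitian G).eigenvalues i

namespace CubicSearch

/-- Instructions for processing a queue of adjacency patterns. A pattern lists, for each vertex
(newest first), its adjacencies to the older vertices. -/
inductive Step
  /-- The first pattern in the queue violates the eigenvalue bound on the given vector. -/
  | cut (x : List ℤ)
  /-- Replace the first pattern by its extensions by a neighbour of the vertex at position `p`. -/
  | grow (p : ℕ)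
  /-- The first pattern is a cubic graph with a root representation, so `-2 ≤ λmin`. -/
  | closed (r : List ℕ)
  /-- The first pattern is the target graph. -/
  | final

/-- The degrees of the vertices of a pattern. -/
def degrees : List (List Bool) → List ℕ
  | [] => []
  | N :: s => N.countP id :: List.zipWith (fun d b => d + b.toNat) (degrees s) N

/-- The sublists of marks with at most `r` entries, supported on the given positions. -/
def masks : List Bool → ℕ → List (List Bool)
  | [], _ => [[]]
  | false :: f, r => (masks f r).map (false :: ·)
  | true :: f, 0 => (masks f 0).map (false :: ·)
  | true :: f, r + 1 => (masks f (r + 1)).map (false :: ·) ++ (masks f r).map (true :: ·)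

/-- The positions of the vertices of degree less than three. -/
def free (s : List (List Bool)) : List Bool := (degrees s).map fun d => Nat.blt d 3

/-- The patterns of maximum degree at most three that arise by adding a neighbour of the vertex at
position `p`. -/
def extensions (s : List (List Bool)) (p : ℕ) : List (List (List Bool)) :=
  ((masks (free s) 3).filter fun N => N.getD p false).map (· :: s)

/-- The sum of the coordinates at the marked positions. -/
def nbrSum : List Bool → List ℤ → ℤ
  | true :: N, a :: x => a + nbrSum N x
  | false :: N, _ :: x => nbrSum N x
  | _, _ => 0

/-- The quadratic form of `51 + 25 A`, where `A` is the adjacency matrix of the pattern. -/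
def quad : List (List Bool) → List ℤ → ℤ
  | N :: s, a :: x => a * (51 * a + 50 * nbrSum N x) + quad s x
  | _, _ => 0

/-- Whether an integer is negative. -/
def isNeg : ℤ → Bool
  | .ofNat _ => false
  | .negSucc _ => true

/-- The inner product of two vectors of length eight. -/
def dot (g h : List ℤ) : ℤ :=
  g.getD 0 0 * h.getD 0 0 + g.getD 1 0 * h.getD 1 0 + g.getD 2 0 * h.getD 2 0
    + g.getD 3 0 * h.getD 3 0 + g.getD 4 0 * h.getD 4 0 + g.getD 5 0 * h.getD 5 0
    + g.getD 6 0 * h.getD 6 0 + g.getD 7 0 * h.getD 7 0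

/-- Whether `g` has inner product 4 with the marked vectors and 0 with the other ones. -/
def rowCheck (g : List ℤ) : List Bool → List (List ℤ) → Bool
  | [], [] => true
  | b :: N, h :: gs =>
    @decide (dot g h = bif b then 4 else 0) (Int.instDecidableEq _ _) && rowCheck g N gs
  | _, _ => false

/-- Whether the given vectors have Gram matrix `8 + 4 A`. -/
def gramCheck : List (List Bool) → List (List ℤ) → Bool
  | [], [] => true
  | N :: s, g :: gs =>
    @decide (dot g g = 8) (Int.instDecidableEq _ _) && (rowCheck g N gs && gramCheck s gs)
  | _, _ => false

/-- Whether a pattern is nonempty and all its vertices have degree at least three. -/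
def saturated (s : List (List Bool)) : Bool := !s.isEmpty && (free s).all not

/-- Some roots of the lattice `E₈`, scaled by two. -/
def roots : List (List ℤ) :=
  [[1, 1, 1, 1, 1, -1, -1, 1], [-1, -1, -1, 1, 1, 1, -1, 1], [-1, -1, -1, -1, 1, -1, -1, 1],
   [1, 1, 1, -1, 1, 1, -1, 1], [0, 0, 0, -2, 2, 0, 0, 0], [0, 0, 0, 2, 2, 0, 0, 0],
   [0, 0, 0, 0, 2, 0, 2, 0], [0, 0, 0, 0, 0, -2, 0, 2], [0, 0, 0, 0, 0, 2, 0, 2],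
   [0, 0, 0, 0, 0, 0, 2, 2], [1, 1, -1, 1, 1, 1, -1, 1], [-1, -1, 1, 1, 1, -1, -1, 1],
   [1, -1, -1, 1, 1, -1, -1, 1], [-1, 1, -1, 1, 1, -1, -1, 1], [-1, -1, 1, -1, 1, 1, -1, 1],
   [-1, 1, 1, -1, 1, -1, -1, 1], [1, -1, 1, 1, 1, 1, -1, 1], [1, -1, -1, -1, 1, 1, -1, 1],
   [-1, 1, 1, 1, 1, 1, -1, 1], [1, -1, 1, -1, 1, -1, -1, 1], [1, 1, -1, -1, 1, -1, -1, 1],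
   [0, 0, 2, 0, 2, 0, 0, 0], [-1, 1, -1, -1, 1, 1, -1, 1], [0, 2, 0, 2, 0, 0, 0, 0],
   [2, 0, 0, 2, 0, 0, 0, 0], [2, 0, 2, 0, 0, 0, 0, 0], [0, 2, 2, 0, 0, 0, 0, 0],
   [1, 1, 1, -1, 1, 1, 1, -1], [0, 0, 0, 0, 2, 0, 0, 2], [0, 0, 0, 0, 0, 2, 2, 0],
   [2, 2, 0, 0, 0, 0, 0, 0], [-1, 1, 1, 1, 1, 1, 1, -1], [1, 1, 1, 1, 1, 1, 1, 1]]

/-- The cubic graph on 16 vertices with smallest eigenvalue `β`. -/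
def target : List (List Bool) :=
  [ [true, false, true, false, true, false, false, false, false, false, false, false, false, false, false],
   [true, false, false, true, false, false, false, false, false, false, false, false, false, false],
   [true, true, false, false, false, false, false, false, false, false, false, false, false],
   [true, false, false, false, false, false, false, false, false, false, false, false],
   [false, false, true, false, false, false, false, false, false, false, false],
   [true, false, false, false, false, false, false, false, false, false],
   [true, true, false, false, false, false, false, false, false],
   [true, false, false, false, false, false, false, false],
   [true, false, false, false, false, false, false], [true, true, false, false, false, false],
   [true, false, true, false, false], [true, false, false, false], [false, true, true],
   [true, true], [true], []]

/-- The closed neighbourhoods, in a cubic graph, of a vertex whose neighbours do not span exactly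
one edge. -/
def starts : List (List (List Bool)) :=
  [[[false, false, true], [false, true], [true], []],
   [[false, true, true], [true, true], [true], []],
   [[true, true, true], [true, true], [true], []]]

/-- The computable equality test for patterns. -/
def patternDecEq : DecidableEq (List (List Bool)) :=
  @instDecidableEqList _ (@instDecidableEqList _ instDecidableEqBool)

/-- Check that the instructions dispose of all patterns in the queue. -/
def run : List Step → List (List (List Bool)) → Bool
  | [], [] => true
  | .cut x :: cs, s :: st => isNeg (quad s x) && run cs st
  | .grow p :: cs, s :: st => (free s).getD p false && run cs (extensions s p ++ st)
  | .closed r :: cs, s :: st =>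
    saturated s && gramCheck s (r.map fun i => roots.getD i []) && run cs st
  | .final :: cs, s :: st => saturated s && @decide (s = target) (patternDecEq _ _) && run cs st
  | _, _ => false

/-- Instructions that reduce `starts` to `target`. -/
def certificate : List Step :=
  [.grow 0, .grow 1, .grow 0, .cut [1, -2, -2, 4, 2, 2, -4], .grow 1,
  .cut [1, 1, -3, -2, 4, 1, 1, -3], .cut [2, 2, -2, 0, 1, 0, -2, 1], .grow 0,
  .cut [1, -3, -2, 3, 0, -1, 2, 1, -1], .cut [2, -2, 0, 2, 1, -3, 0, -2, 2],
  .cut [1, -1, -1, 3, 2, -4, -1, -1, 3], .cut [1, 0, 1, 0, 0, -1, -1, -2, 2],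
  .cut [1, -2, -1, 1, -1, 1, 2, 1, -2], .grow 2, .cut [1, -1, -1, -2, 2, 1, -1, 1, 2, -1],
  .cut [2, -2, 1, -2, 1, 2, -2, -2, 1, 1], .cut [2, 1, -2, -2, 1, -2, 1, 2, 1, -2],
  .closed [0, 1, 2, 3, 4, 5, 6, 7, 8, 9], .grow 2, .cut [1, 0, -2, -3, 3, 0, -1, 1, 2, -1],
  .cut [1, 0, -1, -1, 3, 2, -4, -1, -1, 3], .cut [2, 1, -1, -2, 1, -2, 1, 1, 2, -2],
  .closed [10, 11, 2, 3, 4, 5, 6, 7, 8, 9], .cut [1, -2, -2, 2, 0, -1, 1, 1, -1],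
  .cut [1, -2, -1, 2, 0, -1, 1, 0, 0], .cut [1, -1, -2, 2, 0, -1, 0, 1, 0],
  .cut [1, -1, -1, 1, 0, 0, 1, 1, -1], .cut [1, 1, -1, 0, 0, -1, -1, 1],
  .cut [1, 1, -2, -1, 2, 0, 0, -1], .cut [1, 1, -1, -1, 1, 0, -1, 0],
  .cut [2, 1, -2, -1, 1, -1, 0, 0], .cut [2, -1, -3, -2, 5, 2, 3, -5], .grow 3,
  .cut [2, 0, 0, -3, -4, 6, 2, 2, -5], .grow 4, .cut [2, 2, 1, 1, -3, -4, 5, 1, 1, -3],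
  .cut [2, 2, 0, 0, -1, -2, 1, -2, -1, 1], .cut [2, -1, 0, 0, -2, -3, 5, 3, 2, -5],
  .closed [12, 13, 14, 3, 4, 5, 6, 7, 8, 9], .grow 5, .cut [1, 1, 0, 1, 1, -3, -3, -2, 4],
  .cut [1, 1, 1, 0, 0, -1, -2, -2, 2], .grow 0, .cut [1, -3, -2, 0, 1, 2, -1, 3, 0, -1],
  .cut [2, -2, -1, 1, 1, 2, -2, 1, -2, 1], .cut [1, -1, -1, 0, -1, -1, 3, 3, 2, -4],
  .closed [1, 12, 15, 3, 4, 5, 6, 7, 8, 9], .cut [2, 1, 1, 0, -1, 0, -2, -2, 1],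
  .cut [1, 0, -1, -1, 2, 1, 1, -2], .grow 1, .cut [1, 1, -3, -2, 4, 1, 1, -3], .grow 0,
  .cut [1, -3, -2, 3, 0, -1, 1, 2, -1], .cut [1, -1, -1, 3, 2, -4, -1, -1, 3],
  .cut [2, -2, 0, 2, 1, -3, -2, 0, 2], .cut [1, 0, 1, 0, 0, -1, -2, -1, 2],
  .cut [1, -2, -1, 1, -1, 1, 1, 2, -2], .grow 2, .cut [1, 0, -2, -3, 3, 0, -1, 2, 1, -1],
  .cut [1, 0, -1, -1, 3, 2, -4, -1, -1, 3], .cut [2, 1, -1, -2, 1, -2, 1, 2, 1, -2],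
  .closed [13, 16, 17, 15, 4, 5, 6, 7, 8, 9], .grow 2, .cut [1, -1, -1, -2, 2, 1, -1, 2, 1, -1],
  .cut [2, -2, 1, -2, 1, 2, -2, 1, -2, 1], .cut [2, 1, -2, -2, 1, -2, 1, 1, 2, -2],
  .closed [18, 12, 17, 15, 4, 5, 6, 7, 8, 9], .cut [1, -2, -2, 2, 0, -1, 1, 1, -1],
  .cut [1, -1, -2, 2, 0, -1, 1, 0, 0], .cut [1, -2, -1, 2, 0, -1, 0, 1, 0],
  .cut [1, -1, -1, 1, 0, 0, 1, 1, -1], .cut [2, 2, -2, 0, 1, -2, 0, 1],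
  .cut [1, 1, -1, 0, 0, -1, -1, 1], .cut [1, 1, -2, -1, 2, 0, 0, -1],
  .cut [2, 1, -2, -1, 1, 0, -1, 0], .cut [1, 1, -1, -1, 1, -1, 0, 0],
  .cut [2, -1, -3, -2, 5, 3, 2, -5], .grow 5, .cut [1, 0, 1, 1, 1, -3, -3, -2, 4],
  .cut [1, 1, 1, 0, 0, -1, -2, -2, 2], .grow 0, .cut [1, -3, 0, -2, 1, 2, -1, 3, 0, -1],
  .cut [2, -2, 1, -1, 1, 2, -2, 1, -2, 1], .cut [1, -1, 0, -1, -1, -1, 3, 3, 2, -4],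
  .closed [1, 12, 3, 15, 4, 5, 6, 7, 8, 9], .cut [2, 1, 1, 0, -1, 0, -2, -2, 1], .grow 3,
  .cut [2, 0, 0, -3, -4, 6, 2, 2, -5], .grow 4, .cut [2, 2, 1, 1, -3, -4, 5, 1, 1, -3],
  .cut [2, 2, 0, 0, -1, -2, 1, -1, -2, 1], .cut [2, -1, 0, 0, -2, -3, 5, 2, 3, -5],
  .closed [1, 10, 19, 15, 4, 5, 6, 7, 8, 9], .cut [1, 0, -1, -1, 2, 1, 1, -2],
  .cut [2, 0, 0, -1, -2, -2, 2], .cut [1, -2, -2, 2, 1, 1, -2], .cut [2, -2, -2, 2, 0, 0, -1],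
  .cut [2, -2, -2, 2, 0, 0, -1], .cut [1, 1, -2, -1, -1, 2], .cut [1, 1, -2, -1, -1, 2],
  .cut [1, 0, -1, -1, -1, 1], .grow 0, .grow 4, .grow 5, .cut [1, 1, -1, 1, 1, -3, -3, -2, 4],
  .cut [1, 1, 0, 0, 0, -1, -2, -1, 2], .cut [2, 1, -1, 2, -1, -2, -3, -1, 3],
  .cut [2, 1, 0, 1, -1, -1, -2, -1, 2], .cut [1, 1, -1, 1, 0, -1, -2, -1, 2],
  .cut [1, 0, -1, 1, 0, -1, -1, -1, 1], .cut [2, 1, -1, 1, -1, -1, -2, 0, 1], .grow 7,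
  .cut [1, 1, 1, -1, 1, 1, -3, -3, -2, 4], .cut [1, 1, 1, -1, 2, 0, -3, -3, -2, 4],
  .cut [1, 1, 1, -1, 1, 0, -2, -2, -2, 3], .cut [2, 0, 0, -2, 2, -1, -1, -1, -1, 1],
  .cut [2, 2, 0, -1, 2, 1, -4, -4, -4, 6], .grow 1, .cut [1, -4, -3, 2, 1, -3, 2, 2, 2, 4, -4],
  .cut [2, 3, 0, -1, -1, 2, -2, -2, -1, -3, 3], .cut [2, -9, -6, 5, 2, -6, 5, 5, 5, 9, -9],
  .cut [2, 1, -1, 0, -1, 1, -1, -1, 0, -2, 1], .cut [2, 1, -1, -1, 1, 0, -1, -1, -2, 2],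
  .cut [2, 0, 2, -1, 2, 1, -4, -4, -4, 6], .grow 2, .cut [1, -4, 2, -3, 1, -3, 2, 2, 2, 4, -4],
  .cut [2, 3, -1, 0, -1, 2, -2, -2, -1, -3, 3], .cut [2, -9, 5, -6, 2, -6, 5, 5, 5, 9, -9],
  .cut [2, 1, 0, -1, -1, 1, -1, -1, 0, -2, 1], .cut [2, -1, 1, -1, 1, 0, -1, -1, -2, 2], .grow 8,
  .cut [1, 1, 0, 0, -1, 1, 1, -3, -2, -3, 4], .cut [2, 1, 0, 0, -1, 2, -1, -2, -1, -3, 3],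
  .cut [1, 1, 0, 0, -1, 1, 0, -1, -1, -2, 2], .cut [2, 1, 0, 0, -1, 1, -1, -1, 0, -2, 1],
  .cut [2, 0, 0, 1, 0, -1, -2, -2, 2], .grow 7, .cut [1, 1, 1, -1, 2, 0, -3, -3, -2, 4],
  .cut [2, 1, 0, -2, 2, 0, -2, -2, -2, 3], .grow 0, .cut [1, -2, -2, 1, 1, -2, 1, 2, 2, 2, -3],
  .cut [2, 1, 2, 1, -1, 3, 0, -5, -5, -5, 7], .cut [4, -7, -4, 4, -1, -2, 1, 4, 3, 7, -7],
  .cut [2, 0, 1, 1, -2, 2, 0, -2, -2, -2, 2], .cut [2, 1, -1, -2, 2, -1, -1, -1, -2, 2],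
  .cut [2, 0, -2, 2, 0, -2, -2, -1, 3], .cut [2, 0, 1, 0, -1, -2, -2, 2], .grow 5,
  .cut [1, 2, -1, 2, -1, -2, -3, -1, 3], .cut [1, 1, 0, 1, 0, -1, -2, -1, 2],
  .cut [1, 1, -1, 1, -1, -1, -2, -1, 2], .cut [1, 0, -1, 1, 0, -1, -1, -1, 1], .grow 7,
  .cut [1, 1, 1, -1, 2, 0, -3, -3, -2, 4], .cut [2, 0, 1, -2, 2, 0, -2, -2, -2, 3], .grow 0,
  .cut [1, -2, 1, -2, 1, -2, 1, 2, 2, 2, -3], .cut [2, 1, 1, 2, -1, 3, 0, -5, -5, -5, 7],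
  .cut [4, -7, 4, -4, -1, -2, 1, 4, 3, 7, -7], .cut [2, 0, 1, 1, -2, 2, 0, -2, -2, -2, 2],
  .cut [2, -1, 1, -2, 2, -1, -1, -1, -2, 2], .cut [2, 0, 0, 1, 1, -2, -2, -2, 2],
  .cut [2, 0, -2, 2, 0, -2, -2, -1, 2], .cut [2, 0, 1, -1, -1, -2, -2, 2],
  .cut [2, -2, 2, 0, -2, -2, -1, 2], .cut [1, -1, 1, 0, -1, -1, -1, 1],
  .cut [2, -2, 2, -1, -1, -1, -1, 1], .grow 5, .cut [2, 3, -1, 2, -3, -2, -5, 5],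
  .cut [1, 1, 0, 0, -1, -1, -2, 2], .grow 0, .cut [1, -3, -2, 0, 1, 1, 1, 4, -3], .grow 0,
  .cut [1, -3, 3, 0, 0, -2, 1, 2, -1, -1], .cut [1, -1, 3, 2, 0, -1, -1, -1, -4, 3],
  .cut [2, -2, 1, -2, 1, -1, 1, 2, 1, -2], .closed [20, 2, 1, 3, 21, 5, 6, 7, 8, 9],
  .cut [1, -2, -2, 1, 1, 0, 0, 2, -1], .cut [2, -2, -2, 1, 1, 0, -1, 1, 0],
  .cut [2, 1, 0, -1, -1, -1, -2, 2], .grow 0, .grow 6, .cut [1, -1, 2, 0, 1, 1, -3, -2, -3, 4],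
  .grow 0, .cut [1, -2, 1, -2, 1, -2, 1, 2, 2, 2, -3], .cut [2, 1, -1, 3, 0, 2, 1, -5, -5, -5, 7],
  .cut [4, -7, -1, -2, 1, -4, 4, 3, 7, 4, -7], .cut [2, 0, -2, 2, 0, 1, 1, -2, -2, -2, 2],
  .cut [2, -2, 2, 0, 1, 0, -2, -2, -2, 3], .cut [2, -2, 2, -1, 1, -1, -1, -2, -1, 2], .grow 0,
  .cut [2, -4, 2, -3, 1, -2, 3, 4, 3, -5], .grow 0, .cut [1, -3, 0, -2, -1, -1, -2, 5, 5, 5, -7],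
  .cut [2, -2, 0, -1, -1, 0, -2, 2, 2, 2, -2], .cut [2, -2, 1, -1, 1, -2, 1, 2, 1, -2],
  .closed [12, 2, 22, 3, 21, 5, 6, 7, 8, 9], .cut [2, -2, 0, 0, -2, 2, 1, 2, -2], .grow 6,
  .cut [2, 3, -1, 1, 1, -1, -1, -4, -1, 3], .cut [2, 0, 1, 0, -1, -2, -2, 2], .grow 5, .grow 6,
  .cut [2, 2, 1, 1, 1, 1, -3, -4, -3, 4], .grow 0, .cut [1, -2, -1, -1, -1, -1, -1, 4, 4, 4, -6],
  .cut [2, -2, -2, -1, -1, -1, -1, 3, 4, 3, -4], .grow 4, .cut [2, 3, -1, 2, -3, -5, -2, 5],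
  .cut [1, 1, 0, 0, -1, -2, -1, 2], .grow 0, .cut [1, -3, -2, 0, 1, 1, 4, 1, -3], .grow 0,
  .cut [1, -3, 3, 0, 0, -2, 1, -1, 2, -1], .cut [1, -1, 3, 2, 0, -1, -1, -4, -1, 3],
  .cut [2, -2, 1, -2, 1, -1, 1, 1, 2, -2], .closed [22, 17, 12, 15, 21, 5, 6, 7, 8, 9],
  .cut [1, -2, -2, 1, 1, 0, 2, 0, -1], .cut [2, -2, -2, 1, 1, 0, 1, -1, 0],
  .cut [2, 1, 0, -1, -1, -2, -1, 2], .grow 0, .grow 7, .cut [1, -1, 2, 0, 1, 1, -3, -3, -2, 4],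
  .grow 0, .cut [1, -2, 1, -2, 1, -2, 1, 2, 2, 2, -3], .cut [2, 1, -1, 3, 0, 2, 1, -5, -5, -5, 7],
  .cut [4, -7, -1, -2, 1, -4, 4, 3, 4, 7, -7], .cut [2, 0, -2, 2, 0, 1, 1, -2, -2, -2, 2],
  .cut [2, -2, 2, 0, 1, 0, -2, -2, -2, 3], .cut [2, -2, 2, -1, 1, -1, -1, -1, -2, 2], .grow 0,
  .cut [2, -4, 2, -3, 1, -2, 3, 3, 4, -5], .grow 0, .cut [1, -3, 0, -2, -1, -1, -2, 5, 5, 5, -7],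
  .cut [2, -2, 0, -1, -1, 0, -2, 2, 2, 2, -2], .cut [2, -2, 1, -1, 1, -2, 1, 1, 2, -2],
  .closed [1, 17, 20, 15, 21, 5, 6, 7, 8, 9], .cut [2, -2, 0, 0, -2, 2, 2, 1, -2], .grow 7,
  .cut [2, 3, -1, 1, 1, -1, -1, -1, -4, 3], .cut [2, 0, 1, 0, -1, -2, -2, 2], .grow 6, .grow 7,
  .cut [2, 2, 1, 1, 1, 1, -3, -3, -4, 4], .grow 0, .cut [1, -2, -1, -1, -1, -1, -1, 4, 4, 4, -6],
  .cut [2, -2, -2, -1, -1, -1, -1, 3, 3, 4, -4], .cut [2, -1, 1, -1, -2, -2, 2], .grow 0,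
  .cut [2, -4, 3, 3, -5, -2, -2, 5], .cut [1, -1, 1, 1, -2, -1, -1, 2],
  .cut [1, -1, 1, 1, -2, -1, -1, 2], .cut [1, -1, 1, 1, -1, -1, -1, 1], .grow 5, .grow 0,
  .cut [2, -4, -3, 0, 0, 2, 2, 6, -5], .grow 1, .cut [2, 2, -4, -3, 1, 1, 1, 1, 5, -3],
  .cut [2, 2, -2, -1, 0, 0, -1, -2, 1, 1], .cut [2, -1, -3, -2, 0, 0, 2, 3, 5, -5],
  .closed [2, 20, 17, 18, 21, 5, 6, 7, 8, 9], .cut [1, 1, 0, 0, -1, -1, -2, 2], .grow 4, .grow 0,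
  .cut [2, -4, -3, 0, 0, 2, 6, 2, -5], .grow 1, .cut [2, 2, -4, -3, 1, 1, 1, 5, 1, -3],
  .cut [2, 2, -2, -1, 0, 0, -1, 1, -2, 1], .cut [2, -1, -3, -2, 0, 0, 2, 5, 3, -5],
  .closed [17, 22, 2, 0, 21, 5, 6, 7, 8, 9], .cut [1, 1, 0, 0, -1, -2, -1, 2],
  .cut [2, 0, -2, -1, -2, 2], .cut [2, 0, -2, -2, -1, 2], .cut [2, -2, -1, -2, 2],
  .cut [2, -2, -2, -1, 2], .cut [1, -1, -1, -1, 1], .grow 0, .grow 2, .grow 0, .grow 1,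
  .cut [2, 2, -5, -2, 4, 5, -3, -3], .cut [1, 1, -2, -1, 1, 2, -1, -1], .grow 0, .grow 4, .grow 5,
  .cut [1, 1, 0, 1, 0, -2, -2, 3, 3, -2, -2], .cut [2, 1, -1, 1, -1, -1, -3, 3, 2, -2, -2],
  .cut [1, 1, -1, 1, 0, -1, -2, 2, 1, -1, -1], .cut [2, 1, -1, 1, -1, 0, -2, 1, 1, -1, -1],
  .cut [1, 1, -1, 2, 1, -4, -4, 6, 6, -4, -4], .grow 1,
  .cut [1, -1, -2, 1, -2, -1, 4, 4, -6, -6, 4, 4], .grow 0,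
  .cut [1, -3, -2, 3, 2, -2, 2, 0, -1, 1, 0, 0, 0],
  .cut [1, -1, 1, 2, -1, 2, 1, -4, -4, 6, 6, -4, -4], .cut [2, 0, -2, 2, 0, -2, -2, 3, 3, -2, -2],
  .grow 0, .cut [2, -4, 1, -2, 2, 1, 4, -4, -3, 2, 2], .grow 0,
  .cut [1, -2, -1, 1, -2, -1, 4, 4, -6, -6, 4, 4], .grow 0,
  .cut [1, -3, 3, -2, 2, -2, 2, 0, -1, 1, 0, 0, 0],
  .cut [1, -1, 2, 1, -1, 2, 1, -4, -4, 6, 6, -4, -4], .cut [3, -5, -1, -1, 3, 0, 4, -4, -2, 2, 2],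
  .cut [2, 0, -2, 2, 0, -2, -2, 3, 3, -2, -2], .cut [2, -2, 2, 0, -2, -2, 3, 3, -2, -2],
  .cut [2, -2, 2, -2, 0, -1, 1, 1, -1, -1], .grow 0, .cut [3, -7, 4, -3, 2, 7, -7, -5, 4, 4],
  .grow 0, .grow 0, .cut [1, -3, 4, 0, 2, 2, -6, -6, 8, 8, -5, -5], .grow 0,
  .cut [1, -3, 2, -2, 2, -2, 3, -1, 0, 0, 1, 0, 0],
  .cut [1, -1, -1, 2, 1, 1, 2, -4, -4, 6, 6, -4, -4], .cut [2, -2, 0, 0, -2, 2, 2, -3, -3, 2, 2],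
  .cut [2, -2, 2, -2, 0, 1, -1, -1, 1, 1], .closed [23, 24, 25, 26, 27, 5, 28, 29, 8, 9],
  .cut [2, -2, -2, 4, 2, -4, -5, 3, 3], .grow 4, .cut [2, 3, -1, -1, 1, -4, 3, 1, -1, -1],
  .cut [2, 0, -2, -2, 2, 2, -1, -1], .cut [2, -2, -2, 2, 2, -1, -1], .grow 0, .grow 2, .grow 0,
  .cut [2, -4, 2, -5, 6, -3, 2, 0, 0], .grow 1, .cut [2, 2, -4, 1, -3, 5, -3, 1, 1, 1],
  .cut [2, 2, -2, -2, 1, 1, -1, -1, 0, 0], .cut [2, -1, -3, 3, -5, 5, -2, 2, 0, 0],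
  .closed [30, 25, 24, 26, 31, 5, 28, 29, 8, 9], .cut [1, -1, 2, -2, 1, -1, 0, 0], .grow 0,
  .grow 0, .grow 1, .cut [2, 2, -4, 4, -2, -2, 3, 3, -2, -2], .grow 0, .grow 2, .grow 0, .grow 1,
  .cut [2, 2, -4, 0, 1, 4, -6, 7, -4, -4, 5, 5, -3, -3],
  .cut [2, 1, -3, -2, 1, 2, -4, 4, -2, -2, 3, 3, -2, -2], .grow 0,
  .cut [2, -4, -2, 8, 2, -5, -10, 18, -22, 13, 13, -18, -18, 12, 12], .grow 0,
  .cut [1, -3, 2, 0, -2, 2, -2, 2, 0, 0, 0, 0, 0, 0, 0, 0],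
  .cut [2, 1, 1, 2, -5, -5, 7, 7, -15, 18, -11, -11, 15, 15, -10, -10],
  .cut [2, -2, 2, -2, 0, 2, -1, 1, 0, 0, 0, 0, 0, 0, 0, 0], .final,
  .cut [2, -2, -2, 4, 0, -1, -4, 6, -7, 4, 4, -5, -5, 3, 3],
  .cut [2, -1, -1, 2, -2, 2, -2, 0, 0, 0, 0, 0, 0, 0, 0],
  .cut [2, 0, -2, -2, 2, 2, -4, 4, -2, -2, 3, 3, -2, -2],
  .cut [2, -2, -2, 2, 2, -4, 4, -2, -2, 3, 3, -2, -2], .grow 0,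
  .cut [1, -2, 2, -2, 2, 0, 0, 0, 0, 0, 0, 0, 0], .grow 0, .grow 0, .grow 1,
  .cut [2, 2, -4, 4, -2, -2, 3, 3, -6, 7, -4, -4, 6, 6, -4, -4], .grow 0,
  .cut [2, -3, -2, 7, -9, 6, 6, -9, -9, 21, -25, 15, 15, -20, -20, 13, 13],
  .cut [2, -2, -2, 4, -4, 2, 2, -3, -3, 6, -7, 4, 4, -6, -6, 4, 4],
  .cut [2, -2, -2, 4, -4, 2, 2, -3, -3, 2, 2], .cut [2, -2, -2, 1, 1], .closed [32, 29, 8, 9]]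

/-- This takes precedence over classical decidability, so that `decide` can evaluate. -/
instance boolDecEq (a b : Bool) : Decidable (a = b) := instDecidableEqBool a b

theorem run_certificate : run certificate starts = true := by decide +kernel

section Patterns

variable {V : Type}

/-- Each vertex of the list is recorded by its adjacencies to the later entries. -/
noncomputable def pattern (G : SimpleGraph V) : List V → List (List Bool)
  | [] => []
  | v :: vs => vs.map (fun u => decide (G.Adj v u)) :: pattern G vs

lemma length_pattern (G : SimpleGraph V) (vs : List V) : (pattern G vs).length = vs.length := by
  induction vs with
  | nil => rfl
  | cons v vs ih => simp [pattern, ih]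

lemma degrees_pattern (G : SimpleGraph V) (vs : List V) :
    degrees (pattern G vs) = vs.map fun v => vs.countP fun u => decide (G.Adj v u) := by
  induction vs with
  | nil => rfl
  | cons v vs ih =>
    simp only [pattern, degrees, ih, List.map_cons, List.countP_cons, List.countP_map]
    congr 1
    · simp
    · rw [List.zipWith_map, List.zipWith_self]
      refine List.map_congr_left fun u _ => ?_
      by_cases h : G.Adj v u <;> simp [h, G.adj_comm u v]

lemma map_mem_masks (a f : V → Bool) (vs : List V) (r : ℕ)
    (haf : ∀ v ∈ vs, a v = true → f v = true) (hr : vs.countP a ≤ r) :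
    vs.map a ∈ masks (vs.map f) r := by
  induction vs generalizing r with
  | nil => cases r <;> simp [masks]
  | cons v vs ih =>
    have haf' : ∀ v ∈ vs, a v = true → f v = true := fun u hu => haf u (by simp [hu])
    have hv := haf v (by simp)
    rw [List.countP_cons] at hr
    cases ha : a v
    · have := ih r haf' (by simpa [ha] using hr)
      cases hf : f v
      · simp [masks, ha, hf, this]
      · cases r <;> simp [masks, ha, hf, this]
    · rw [ha] at hr
      obtain _ | r := r
      · simp at hr
      · have := ih r haf' (by simpa using hr)
        simp [masks, ha, hv ha, this]

lemma free_pattern (G : SimpleGraph V) (vs : List V) : free (pattern G vs) =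
    vs.map fun v => Nat.blt (vs.countP fun u => decide (G.Adj v u)) 3 := by
  simp [free, degrees_pattern]

/-- The vector with the given coordinates on the vertices of a list. -/
noncomputable def vec : List ℤ → List V → V → ℝ
  | a :: x, v :: vs => Pi.single v (a : ℝ) + vec x vs
  | _, _ => 0

lemma vec_of_notMem (x : List ℤ) {vs : List V} {v : V} (hv : v ∉ vs) : vec x vs v = 0 := by
  induction vs generalizing x with
  | nil => cases x <;> rfl
  | cons u us ih =>
    obtain _ | ⟨a, x⟩ := x
    · rfl
    · simp only [List.mem_cons, not_or] at hv
      simp [vec, ih x hv.2, hv.1]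

lemma rowCheck_map (g : List ℤ) (γ : V → List ℤ) (a : V → Bool) (vs : List V)
    (h : rowCheck g (vs.map a) (vs.map γ) = true) :
    ∀ u ∈ vs, dot g (γ u) = bif a u then 4 else 0 := by
  induction vs with
  | nil => simp
  | cons v vs ih =>
    simp only [List.map_cons, rowCheck, Bool.and_eq_true, decide_eq_true_eq] at h
    simpa using ⟨h.1, ih h.2⟩

lemma dot_comm (g h : List ℤ) : dot g h = dot h g := by
  simp only [dot, mul_comm]

lemma exists_gram {G : SimpleGraph V} {vs : List V} (hvs : vs.Nodup) {gs : List (List ℤ)}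
    (h : gramCheck (pattern G vs) gs = true) :
    ∃ γ : V → List ℤ, gs = vs.map γ ∧ ∀ u ∈ vs, ∀ v ∈ vs,
      dot (γ u) (γ v) = if u = v then 8 else if G.Adj u v then 4 else 0 := by
  induction vs generalizing gs with
  | nil =>
    obtain _ | ⟨g, gs⟩ := gs
    · exact ⟨fun _ => [], by simp⟩
    · simp [pattern, gramCheck] at h
  | cons v vs ih =>
    obtain _ | ⟨g, gs⟩ := gs
    · simp [pattern, gramCheck] at h
    obtain ⟨hv, hvs⟩ := List.nodup_cons.1 hvs
    simp only [pattern, gramCheck, Bool.and_eq_true, decide_eq_true_eq] at h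
    obtain ⟨hg, hrow, h⟩ := h
    obtain ⟨γ, rfl, hγ⟩ := ih hvs h
    have hrow := rowCheck_map g γ _ vs hrow
    have hne : ∀ u ∈ vs, u ≠ v := fun u hu e => hv (e ▸ hu)
    refine ⟨Function.update γ v g, ?_, ?_⟩
    · simp only [List.map_cons, Function.update_self]
      congr 1
      exact List.map_congr_left fun u hu => by rw [Function.update_of_ne (hne u hu)]
    · intro a ha b hb
      rcases List.mem_cons.1 ha with rfl | ha' <;> rcases List.mem_cons.1 hb with rfl | hb'
      · simpa using hg
      · rw [Function.update_self, Function.update_of_ne (hne b hb'), hrow b hb',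
          if_neg (hne b hb').symm]
        simp [Bool.cond_decide]
      · rw [Function.update_self, Function.update_of_ne (hne a ha'), dot_comm, hrow a ha',
          if_neg (hne a ha'), G.adj_comm]
        simp [Bool.cond_decide]
      · rw [Function.update_of_ne (hne a ha'), Function.update_of_ne (hne b hb'), hγ a ha' b hb']

variable [Fintype V] {G : SimpleGraph V}

lemma countP_adj {vs : List V} (hvs : vs.Nodup) (v : V) :
    vs.countP (fun u => decide (G.Adj v u)) = (G.neighborFinset v ∩ vs.toFinset).card := by
  rw [List.countP_eq_length_filter, ← List.toFinset_card_of_nodup (hvs.filter _)]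
  congr 1
  ext u
  simp [and_comm]

lemma countP_adj_le (hG : G.IsRegularOfDegree 3) {vs : List V} (hvs : vs.Nodup) (v : V) :
    vs.countP (fun u => decide (G.Adj v u)) ≤ 3 := by
  rw [countP_adj hvs, ← hG v, ← G.card_neighborFinset_eq_degree]
  exact Finset.card_le_card Finset.inter_subset_left

lemma exists_adj_notMem (hG : G.IsRegularOfDegree 3) {vs : List V} (hvs : vs.Nodup) {v : V}
    (h : vs.countP (fun u => decide (G.Adj v u)) < 3) : ∃ w ∉ vs, G.Adj v w := by
  rw [countP_adj hvs, ← hG v, ← G.card_neighborFinset_eq_degree] at h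
  by_contra! hc
  refine h.ne (congrArg _ (Finset.inter_eq_left.2 fun w hw => ?_))
  by_contra hw'
  exact hc w (by simpa using hw') (by simpa using hw)

lemma countP_adj_lt (hG : G.IsRegularOfDegree 3) {vs : List V} (hvs : vs.Nodup) {v w : V}
    (hw : w ∉ vs) (h : G.Adj v w) : vs.countP (fun u => decide (G.Adj v u)) < 3 := by
  rw [countP_adj hvs, ← hG v, ← G.card_neighborFinset_eq_degree]
  refine Finset.card_lt_card ⟨Finset.inter_subset_left, fun hs => hw ?_⟩
  simpa using (Finset.mem_inter.1 (hs (by simpa using h : w ∈ G.neighborFinset v))).2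

lemma exists_extension (hG : G.IsRegularOfDegree 3) {vs : List V} (hvs : vs.Nodup) {p : ℕ}
    (hp : (free (pattern G vs)).getD p false = true) :
    ∃ w, (w :: vs).Nodup ∧ pattern G (w :: vs) ∈ extensions (pattern G vs) p := by
  rw [free_pattern, List.getD_eq_getElem?_getD, List.getElem?_map] at hp
  cases hv : vs[p]? with
  | none => simp [hv] at hp
  | some v =>
    rw [hv] at hp
    obtain ⟨w, hw, hvw⟩ := exists_adj_notMem hG hvs (v := v) (by simpa [Nat.blt_eq] using hp)
    refine ⟨w, List.nodup_cons.2 ⟨hw, hvs⟩, ?_⟩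
    simp only [extensions, pattern, List.mem_map, List.mem_filter]
    refine ⟨_, ⟨?_, ?_⟩, rfl⟩
    · rw [free_pattern]
      refine map_mem_masks _ _ _ _ (fun u _ hu => ?_) (countP_adj_le hG hvs w)
      exact Nat.blt_eq.mpr (countP_adj_lt hG hvs hw (by simpa [G.adj_comm] using hu))
    · simp [List.getD_eq_getElem?_getD, hv, hvw.symm]

lemma mem_of_saturated (hG : G.IsRegularOfDegree 3) (hc : G.Connected) {vs : List V}
    (hvs : vs.Nodup) (hs : saturated (pattern G vs) = true) (v : V) : v ∈ vs := by
  simp only [saturated, free_pattern, Bool.and_eq_true, List.all_map, List.all_eq_true] at hs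
  obtain ⟨h0, hs⟩ := hs
  obtain _ | ⟨u, us⟩ := vs
  · simp [pattern] at h0
  · have key : ∀ {a b : V} (w : G.Walk a b), a ∈ u :: us → b ∈ u :: us := by
      intro a b w
      induction w with
      | nil => exact id
      | cons h _ ih =>
        intro ha
        refine ih ?_
        by_contra hb
        have := hs _ ha
        simp only [Function.comp_apply, Nat.blt_eq.mpr (countP_adj_lt hG hvs hb h)] at this
        simp at this
    obtain ⟨w⟩ := hc.preconnected u v
    exact key w (by simp)

lemma adjMatrix_mulVec_vec (x : List ℤ) (vs : List V) (v : V) :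
    (G.adjMatrix ℝ).mulVec (vec x vs) v =
      (nbrSum (vs.map fun u => decide (G.Adj v u)) x : ℤ) := by
  induction vs generalizing x with
  | nil => cases x <;> simp [vec, nbrSum]
  | cons u us ih =>
    obtain _ | ⟨a, x⟩ := x
    · by_cases h : G.Adj v u <;> simp [vec, nbrSum, h]
    · by_cases h : G.Adj v u <;> simp only [vec, Matrix.mulVec_add, Pi.add_apply, ih,
        List.map_cons, Matrix.mulVec_single] <;> simp [nbrSum, h]

lemma quad_pattern (x : List ℤ) {vs : List V} (hvs : vs.Nodup) :
    (quad (pattern G vs) x : ℝ) = 51 * (vec x vs ⬝ᵥ vec x vs) +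
      25 * (vec x vs ⬝ᵥ (G.adjMatrix ℝ).mulVec (vec x vs)) := by
  induction vs generalizing x with
  | nil => cases x <;> simp [vec, pattern, quad]
  | cons u us ih =>
    obtain _ | ⟨a, x⟩ := x
    · simp [vec, pattern, quad]
    · obtain ⟨hu, hus⟩ := List.nodup_cons.1 hvs
      have hsymm : vec x us ⬝ᵥ (G.adjMatrix ℝ).mulVec (Pi.single u (a : ℝ)) =
          Pi.single u (a : ℝ) ⬝ᵥ (G.adjMatrix ℝ).mulVec (vec x us) := by
        rw [Matrix.dotProduct_mulVec, ← Matrix.mulVec_transpose, G.transpose_adjMatrix,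
          dotProduct_comm]
      simp only [vec, pattern, quad, Matrix.mulVec_add, add_dotProduct, dotProduct_add, hsymm,
        single_dotProduct, dotProduct_single, adjMatrix_mulVec_vec, Int.cast_add, Int.cast_mul,
        ih x hus]
      simp [vec_of_notMem x hu]
      ring

lemma dotProduct_adjMatrix_mulVec (y : V → ℝ) :
    y ⬝ᵥ (G.adjMatrix ℝ).mulVec y = ∑ u, ∑ v, if G.Adj u v then y u * y v else 0 := by
  simp [dotProduct, Matrix.mulVec, Finset.mul_sum, adjMatrix_apply]

lemma neg_two_le_of_gram {vs : List V} (hvs : vs.Nodup) (hall : ∀ v, v ∈ vs)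
    {gs : List (List ℤ)} (h : gramCheck (pattern G vs) gs = true) (y : V → ℝ) :
    -2 * (y ⬝ᵥ y) ≤ y ⬝ᵥ (G.adjMatrix ℝ).mulVec y := by
  obtain ⟨γ, -, hγ⟩ := exists_gram hvs h
  have hγ' (u v : V) : (if u = v then 8 else if G.Adj u v then 4 else 0 : ℝ) =
      ∑ c : Fin 8, ((γ u).getD c 0 : ℝ) * ((γ v).getD c 0 : ℝ) := by
    have := congrArg (Int.cast (R := ℝ)) (hγ u (hall u) v (hall v))
    simp only [dot] at this
    push_cast at this
    rw [← this, Fin.sum_univ_eight]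
    rfl
  have hsq : ∑ c : Fin 8, (∑ u, y u * ((γ u).getD c 0 : ℝ)) ^ 2 =
      ∑ u, ∑ v, y u * y v * (if u = v then 8 else if G.Adj u v then 4 else 0 : ℝ) := by
    simp only [hγ', sq, Finset.sum_mul_sum]
    simp only [Finset.mul_sum]
    rw [Finset.sum_comm]
    refine Finset.sum_congr rfl fun u _ => ?_
    rw [Finset.sum_comm]
    refine Finset.sum_congr rfl fun v _ => Finset.sum_congr rfl fun c _ => by ring
  have hsplit : ∑ u, ∑ v, y u * y v * (if u = v then 8 else if G.Adj u v then 4 else 0 : ℝ) =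
      8 * (y ⬝ᵥ y) + 4 * (y ⬝ᵥ (G.adjMatrix ℝ).mulVec y) := by
    rw [dotProduct_adjMatrix_mulVec, dotProduct, Finset.mul_sum, Finset.mul_sum,
      ← Finset.sum_add_distrib]
    refine Finset.sum_congr rfl fun u _ => ?_
    have : 8 * (y u * y u) = ∑ v, if u = v then 8 * (y u * y v) else 0 := by simp
    rw [this, Finset.mul_sum, ← Finset.sum_add_distrib]
    refine Finset.sum_congr rfl fun v _ => ?_
    by_cases e : u = v
    · subst e; simp; ring
    · by_cases e' : G.Adj u v <;> simp [e, e']; ring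
  have : 0 ≤ ∑ c : Fin 8, (∑ u, y u * ((γ u).getD c 0 : ℝ)) ^ 2 := by positivity
  linarith

lemma exists_target_of_run (hG : G.IsRegularOfDegree 3) (hc : G.Connected)
    (hlb : ∀ y : V → ℝ, -51 / 25 * (y ⬝ᵥ y) ≤ y ⬝ᵥ (G.adjMatrix ℝ).mulVec y)
    (hub : ∃ y : V → ℝ, y ⬝ᵥ (G.adjMatrix ℝ).mulVec y < -2 * (y ⬝ᵥ y))
    (cs : List Step) (st : List (List (List Bool))) (hrun : run cs st = true)
    (vs : List V) (hvs : vs.Nodup) (hmem : pattern G vs ∈ st) :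
    ∃ ws : List V, ws.Nodup ∧ (∀ v, v ∈ ws) ∧ pattern G ws = target := by
  induction cs generalizing st vs with
  | nil => cases st <;> simp_all [run]
  | cons c cs ih =>
    obtain _ | ⟨s, st⟩ := st
    · simp at hmem
    cases c with
    | cut x =>
      simp only [run, Bool.and_eq_true] at hrun
      rcases List.mem_cons.1 hmem with rfl | hmem
      · exfalso
        have h1 : quad (pattern G vs) x < 0 := by
          have := hrun.1
          cases hq : quad (pattern G vs) x with
          | ofNat n => simp [hq, isNeg] at this
          | negSucc n => exact Int.negSucc_lt_zero n
        have h2 := quad_pattern (G := G) x hvs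
        have h3 : (quad (pattern G vs) x : ℝ) < 0 := by exact_mod_cast h1
        linarith [hlb (vec x vs)]
      · exact ih st hrun.2 vs hvs hmem
    | grow p =>
      simp only [run, Bool.and_eq_true] at hrun
      rcases List.mem_cons.1 hmem with rfl | hmem
      · obtain ⟨w, hw, hext⟩ := exists_extension hG hvs hrun.1
        exact ih _ hrun.2 _ hw (List.mem_append_left _ hext)
      · exact ih _ hrun.2 vs hvs (List.mem_append_right _ hmem)
    | closed r =>
      simp only [run, Bool.and_eq_true] at hrun
      rcases List.mem_cons.1 hmem with rfl | hmem
      · obtain ⟨y, hy⟩ := hub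
        exact absurd (neg_two_le_of_gram hvs (mem_of_saturated hG hc hvs hrun.1.1) hrun.1.2 y)
          hy.not_ge
      · exact ih st hrun.2 vs hvs hmem
    | final =>
      simp only [run, Bool.and_eq_true, decide_eq_true_eq] at hrun
      rcases List.mem_cons.1 hmem with rfl | hmem
      · exact ⟨vs, hvs, mem_of_saturated hG hc hvs hrun.1.1, hrun.1.2⟩
      · exact ih st hrun.2 vs hvs hmem

end Patterns

section Classification

variable {V : Type} [Fintype V] {G : SimpleGraph V}

lemma sum_fiber_mul_nonneg (f : V → V) (y : V → ℝ) :
    0 ≤ ∑ u, ∑ v, if f u = f v then y u * y v else 0 := by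
  have h : ∑ u, ∑ v, (if f u = f v then y u * y v else 0) =
      ∑ q, (∑ u, if f u = q then y u else 0) ^ 2 := by
    simp only [sq, Finset.sum_mul_sum]
    rw [Finset.sum_comm]
    conv_rhs => rw [Finset.sum_comm]
    conv_lhs => rw [Finset.sum_comm]
    refine Finset.sum_congr rfl fun u _ => ?_
    conv_rhs => rw [Finset.sum_comm]
    refine Finset.sum_congr rfl fun v _ => ?_
    by_cases e : f u = f v <;> simp [e, eq_comm]
  rw [h]
  positivity

lemma sum_setoid_mul_nonneg (r : Setoid V) (y : V → ℝ) :
    0 ≤ ∑ u, ∑ v, if r u v then y u * y v else 0 := by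
  have h (u v : V) :
      r u v ↔ (Quotient.mk r u).out = (Quotient.mk r v).out := by
    rw [Quotient.out_inj, Quotient.eq]
  simp only [h]
  exact sum_fiber_mul_nonneg _ y

/-- If every neighbourhood spans exactly one edge, then `G` is a line graph. -/
lemma neg_two_le_of_neighborhoods
    (h : ∀ v, ∃ a b c, (∀ w, G.Adj v w ↔ w = a ∨ w = b ∨ w = c) ∧
      G.Adj a b ∧ ¬ G.Adj a c ∧ ¬ G.Adj b c) (y : V → ℝ) :
    -2 * (y ⬝ᵥ y) ≤ y ⬝ᵥ (G.adjMatrix ℝ).mulVec y := by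
  let T (u v : V) : Prop := G.Adj u v ∧ ∃ w, G.Adj u w ∧ G.Adj v w
  have hT : ∀ u v, T u v → T v u := fun u v ⟨h, w, h₁, h₂⟩ => ⟨h.symm, w, h₂, h₁⟩
  let E : Setoid V :=
    { r := fun u v => u = v ∨ T u v
      iseqv :=
        { refl := fun _ => .inl rfl
          symm := fun {u v} huv => huv.imp Eq.symm (hT u v)
          trans := by
            rintro u v w (rfl | huv) (rfl | hvw)
            · exact .inl rfl
            · exact .inr hvw
            · exact .inr huv
            · obtain ⟨a, b, c, hv, hab, hac, hbc⟩ := h v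
              have key : ∀ x, T v x → x = a ∨ x = b := by
                rintro x ⟨hx, z, hz, hxz⟩
                rcases (hv x).1 hx with rfl | rfl | rfl
                · exact .inl rfl
                · exact .inr rfl
                · rcases (hv z).1 hz with rfl | rfl | rfl
                  · exact absurd hxz.symm hac
                  · exact absurd hxz.symm hbc
                  · exact absurd hxz G.irrefl
              have hu := huv.1
              have hw := hvw.1.symm
              rcases key u (hT _ _ huv) with rfl | rfl <;> rcases key w hvw with rfl | rfl
              · exact .inl rfl
              · exact .inr ⟨hab, v, hu, hw⟩
              · exact .inr ⟨hab.symm, v, hu, hw⟩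
              · exact .inl rfl } }
  let F : Setoid V :=
    { r := fun u v => u = v ∨ (G.Adj u v ∧ ¬ T u v)
      iseqv :=
        { refl := fun _ => .inl rfl
          symm := fun {u v} huv => huv.imp Eq.symm fun h => ⟨h.1.symm, fun h' => h.2 (hT v u h')⟩
          trans := by
            rintro u v w (rfl | huv) (rfl | hvw)
            · exact .inl rfl
            · exact .inr hvw
            · exact .inr huv
            · obtain ⟨a, b, c, hv, hab, hac, hbc⟩ := h v
              have key : ∀ x, G.Adj v x → ¬ T v x → x = c := by
                intro x hx hx'
                rcases (hv x).1 hx with rfl | rfl | rfl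
                · exact absurd ⟨hx, b, (hv b).2 (by simp), hab⟩ hx'
                · exact absurd ⟨hx, a, (hv a).2 (by simp), hab.symm⟩ hx'
                · rfl
              exact .inl ((key u huv.1.symm fun h' => huv.2 (hT _ _ h')).trans
                (key w hvw.1 hvw.2).symm) } }
  have hE := sum_setoid_mul_nonneg E y
  have hF := sum_setoid_mul_nonneg F y
  have hsum : (∑ u, ∑ v, if E u v then y u * y v else 0) +
      (∑ u, ∑ v, if F u v then y u * y v else 0) =
      2 * (y ⬝ᵥ y) + y ⬝ᵥ (G.adjMatrix ℝ).mulVec y := by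
    rw [dotProduct_adjMatrix_mulVec, dotProduct, Finset.mul_sum, ← Finset.sum_add_distrib,
      ← Finset.sum_add_distrib]
    refine Finset.sum_congr rfl fun u _ => ?_
    have h2 : 2 * (y u * y u) = ∑ v, if u = v then 2 * (y u * y v) else 0 := by simp
    rw [h2, ← Finset.sum_add_distrib, ← Finset.sum_add_distrib]
    refine Finset.sum_congr rfl fun v _ => ?_
    have hEuv : E u v ↔ u = v ∨ T u v := Iff.rfl
    have hFuv : F u v ↔ u = v ∨ (G.Adj u v ∧ ¬ T u v) := Iff.rfl
    simp only [hEuv, hFuv]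
    by_cases e : u = v
    · subst e
      simp
      ring
    · by_cases ht : T u v
      · simp [e, ht, ht.1]
      · simp [e, ht]
  linarith

lemma exists_pattern_mem_starts (hG : G.IsRegularOfDegree 3)
    (hub : ∃ y : V → ℝ, y ⬝ᵥ (G.adjMatrix ℝ).mulVec y < -2 * (y ⬝ᵥ y)) :
    ∃ vs : List V, vs.Nodup ∧ pattern G vs ∈ starts := by
  by_contra! hc
  obtain ⟨y, hy⟩ := hub
  refine absurd (neg_two_le_of_neighborhoods (fun v => ?_) y) hy.not_ge
  obtain ⟨a, b, c, hab, hac, hbc, hv⟩ := Finset.card_eq_three.1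
    ((G.card_neighborFinset_eq_degree v).trans (hG v))
  have hadj (w : V) : G.Adj v w ↔ w = a ∨ w = b ∨ w = c := by
    rw [← G.mem_neighborFinset, hv]
    simp
  have ha := (hadj a).2 (by simp)
  have hb := (hadj b).2 (by simp)
  have hc' := (hadj c).2 (by simp)
  have h₁ : ∀ x z w, G.Adj v x → G.Adj v z → G.Adj v w → x ≠ z → x ≠ w → z ≠ w →
      pattern G [x, z, w, v] ∉ starts := fun x z w hx hz hw h1 h2 h3 =>
    hc _ (by simp [h1, h2, h3, hx.ne', hz.ne', hw.ne'])
  by_cases kab : G.Adj a b <;> by_cases kac : G.Adj a c <;> by_cases kbc : G.Adj b c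
  · exact absurd (by simp [pattern, starts, kab, kac, kbc, ha.symm, hb.symm, hc'.symm])
      (h₁ a b c ha hb hc' hab hac hbc)
  · exact absurd (by
      simp [pattern, starts, kab.symm, kac.symm, kbc, G.adj_comm c b, ha.symm, hb.symm, hc'.symm])
      (h₁ c b a hc' hb ha hbc.symm hac.symm hab.symm)
  · exact absurd (by
      simp [pattern, starts, kab, kbc.symm, kac, G.adj_comm c a, ha.symm, hb.symm, hc'.symm])
      (h₁ c a b hc' ha hb hac.symm hbc.symm hab)
  · exact ⟨a, b, c, hadj, kab, kac, kbc⟩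
  · exact absurd (by simp [pattern, starts, kab, kac, kbc, ha.symm, hb.symm, hc'.symm])
      (h₁ a b c ha hb hc' hab hac hbc)
  · exact ⟨a, c, b, fun w => by rw [hadj]; tauto, kac, kab, fun h => kbc h.symm⟩
  · exact ⟨b, c, a, fun w => by rw [hadj]; tauto, kbc, fun h => kab h.symm, fun h => kac h.symm⟩
  · exact absurd (by simp [pattern, starts, kab, kac, kbc, ha.symm, hb.symm, hc'.symm])
      (h₁ a b c ha hb hc' hab hac hbc)

lemma lambdaMin_mul_dotProduct_le (G : SimpleGraph V) (y : V → ℝ) :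
    lambdaMin G * (y ⬝ᵥ y) ≤ y ⬝ᵥ (G.adjMatrix ℝ).mulVec y := by
  set l := lambdaMin G with hl
  have hA := adjMatrix_isHermitian G
  have hB : (G.adjMatrix ℝ - algebraMap ℝ (Matrix V V ℝ) l).IsHermitian := by
    refine hA.sub ?_
    rw [Algebra.algebraMap_eq_smul_one, Matrix.IsHermitian, Matrix.conjTranspose_smul]
    simp
  have hpos : (G.adjMatrix ℝ - algebraMap ℝ (Matrix V V ℝ) l).PosSemidef := by
    rw [hB.posSemidef_iff_eigenvalues_nonneg]
    intro i
    have hi := hB.eigenvalues_mem_spectrum_real i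
    rw [← spectrum.sub_singleton_eq, hA.spectrum_real_eq_range_eigenvalues] at hi
    obtain ⟨_, ⟨j, rfl⟩, _, rfl, hj⟩ := hi
    have : l ≤ hA.eigenvalues j := ciInf_le (Set.finite_range _).bddBelow j
    rw [Pi.zero_apply, ← hj]
    exact sub_nonneg.2 this
  have := hpos.dotProduct_mulVec_nonneg y
  rw [Algebra.algebraMap_eq_smul_one, Matrix.sub_mulVec, Matrix.smul_mulVec, Matrix.one_mulVec,
    dotProduct_sub, dotProduct_smul] at this
  simp only [star_trivial, smul_eq_mul] at this
  linarith

lemma exists_eigenvector_lambdaMin [Nonempty V] (G : SimpleGraph V) :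
    ∃ y : V → ℝ, 0 < y ⬝ᵥ y ∧ y ⬝ᵥ (G.adjMatrix ℝ).mulVec y = lambdaMin G * (y ⬝ᵥ y) := by
  have hA := adjMatrix_isHermitian G
  obtain ⟨i, hi⟩ := exists_eq_ciInf_of_finite (f := hA.eigenvalues)
  have hi : hA.eigenvalues i = lambdaMin G := hi
  refine ⟨hA.eigenvectorBasis i, ?_, ?_⟩
  · have h := EuclideanSpace.real_norm_sq_eq (hA.eigenvectorBasis i)
    rw [hA.eigenvectorBasis.orthonormal.1 i] at h
    have : hA.eigenvectorBasis i ⬝ᵥ hA.eigenvectorBasis i = 1 := by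
      simp only [dotProduct, ← sq, ← h, one_pow]
    rw [this]
    exact one_pos
  · rw [hA.mulVec_eigenvectorBasis, dotProduct_smul, hi, smul_eq_mul]

end Classification

lemma adj_iff_of_pattern_eq {V W : Type} {G : SimpleGraph V} {H : SimpleGraph W} (vs : List V)
    (ws : List W) (h : pattern G vs = pattern H ws) (i j : ℕ) (hi : i < vs.length)
    (hj : j < vs.length) (hi' : i < ws.length) (hj' : j < ws.length) :
    G.Adj vs[i] vs[j] ↔ H.Adj ws[i] ws[j] := by
  induction vs generalizing ws i j with
  | nil => simp at hi
  | cons v vs ih =>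
    obtain _ | ⟨w, ws⟩ := ws
    · simp at hi'
    simp only [pattern, List.cons.injEq] at h
    have hrow (k : ℕ) (hk : k < vs.length) (hk' : k < ws.length) :
        G.Adj v vs[k] ↔ H.Adj w ws[k] := by
      have := congrArg (fun l => l[k]?) h.1
      simpa [hk, hk'] using this
    obtain _ | i := i <;> obtain _ | j := j
    · simp
    · simpa using hrow j (by simpa using hj) (by simpa using hj')
    · simpa [G.adj_comm _ v, H.adj_comm _ w] using hrow i (by simpa using hi) (by simpa using hi')
    · simpa using ih ws h.2 i j (by simpa using hi) (by simpa using hj) (by simpa using hi')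
        (by simpa using hj')

lemma nonempty_iso_of_pattern_eq {V W : Type} {G : SimpleGraph V} {H : SimpleGraph W}
    {vs : List V} {ws : List W} (hvs : vs.Nodup) (hws : ws.Nodup) (hv : ∀ v, v ∈ vs)
    (hw : ∀ w, w ∈ ws) (h : pattern G vs = pattern H ws) : Nonempty (G ≃g H) := by
  have hlen : vs.length = ws.length := by
    rw [← length_pattern G, h, length_pattern]
  let e := hvs.getEquivOfForallMemList vs hv
  let e' := hws.getEquivOfForallMemList ws hw
  refine ⟨⟨e.symm.trans ((finCongr hlen).trans e'), fun {a b} => ?_⟩⟩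
  obtain ⟨i, rfl⟩ := e.surjective a
  obtain ⟨j, rfl⟩ := e.surjective b
  simpa [e, e', hvs.idxOf_getElem] using
    (adj_iff_of_pattern_eq vs ws h i j i.2 j.2 (hlen ▸ i.2) (hlen ▸ j.2)).symm

lemma isLeast_root_bounds {β : ℝ}
    (hβ : IsLeast {x : ℝ | x ^ 6 - 3 * x ^ 5 - 7 * x ^ 4 + 21 * x ^ 3 + 13 * x ^ 2
      - 35 * x - 4 = 0} β) : -51 / 25 ≤ β ∧ β < -2 := by
  constructor
  · by_contra! h
    have hroot : β ^ 6 - 3 * β ^ 5 - 7 * β ^ 4 + 21 * β ^ 3 + 13 * β ^ 2 - 35 * β - 4 = 0 := hβ.1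
    obtain ⟨t, ht, rfl⟩ : ∃ t : ℝ, 0 < t ∧ β = -51 / 25 - t :=
      ⟨-51 / 25 - β, by linarith, by ring⟩
    ring_nf at hroot
    have := pow_pos ht 2
    have := pow_pos ht 3
    have := pow_pos ht 4
    have := pow_pos ht 5
    have := pow_pos ht 6
    linarith
  · have hcont : ContinuousOn (fun x : ℝ => x ^ 6 - 3 * x ^ 5 - 7 * x ^ 4 + 21 * x ^ 3
        + 13 * x ^ 2 - 35 * x - 4) (Set.Icc (-3) (-2)) := by fun_prop
    obtain ⟨x, hx, hx0⟩ := intermediate_value_Icc' (by norm_num) hcont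
      (show (0 : ℝ) ∈ _ by constructor <;> norm_num)
    refine (hβ.2 hx0).trans_lt (lt_of_le_of_ne hx.2 ?_)
    rintro rfl
    norm_num at hx0

lemma exists_pattern_eq_target {V : Type} [Fintype V] {G : SimpleGraph V}
    (hc : G.Connected) (hG : G.IsRegularOfDegree 3) (hlo : -51 / 25 ≤ lambdaMin G)
    (hhi : lambdaMin G < -2) :
    ∃ vs : List V, vs.Nodup ∧ (∀ v, v ∈ vs) ∧ pattern G vs = target := by
  have := hc.nonempty
  have hub : ∃ y : V → ℝ, y ⬝ᵥ (G.adjMatrix ℝ).mulVec y < -2 * (y ⬝ᵥ y) := by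
    obtain ⟨y, hy, h⟩ := exists_eigenvector_lambdaMin G
    exact ⟨y, h ▸ mul_lt_mul_of_pos_right hhi hy⟩
  have hlb (y : V → ℝ) : -51 / 25 * (y ⬝ᵥ y) ≤ y ⬝ᵥ (G.adjMatrix ℝ).mulVec y :=
    (mul_le_mul_of_nonneg_right hlo (Finset.sum_nonneg fun i _ => mul_self_nonneg (y i))).trans
      (lambdaMin_mul_dotProduct_le G y)
  obtain ⟨vs, hvs, hmem⟩ := exists_pattern_mem_starts hG hub
  exact exists_target_of_run hG hc hlb hub _ _ run_certificate vs hvs hmem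

end CubicSearch

/-- Up to isomorphism there is a unique connected 3-regular finite simple graph whose smallest
adjacency eigenvalue equals `β`, the smallest real root of `x⁶-3x⁵-7x⁴+21x³+13x²-35x-4`. -/
theorem stmt_8 (β : ℝ)
    (hβ : IsLeast {x : ℝ | x ^ 6 - 3 * x ^ 5 - 7 * x ^ 4 + 21 * x ^ 3 + 13 * x ^ 2
      - 35 * x - 4 = 0} β)
    (n m : ℕ) (G : SimpleGraph (Fin n)) (H : SimpleGraph (Fin m))
    (hGconn : G.Connected) (hGreg : G.IsRegularOfDegree 3) (hGmin : lambdaMin G = β)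
    (hHconn : H.Connected) (hHreg : H.IsRegularOfDegree 3) (hHmin : lambdaMin H = β) :
    Nonempty (G ≃g H) := by
  obtain ⟨hlo, hhi⟩ := CubicSearch.isLeast_root_bounds hβ
  obtain ⟨vs, hvs, hv, h⟩ :=
    CubicSearch.exists_pattern_eq_target hGconn hGreg (hGmin ▸ hlo) (hGmin ▸ hhi)
  obtain ⟨ws, hws, hw, h'⟩ :=
    CubicSearch.exists_pattern_eq_target hHconn hHreg (hHmin ▸ hlo) (hHmin ▸ hhi)
  exact CubicSearch.nonempty_iso_of_pattern_eq hvs hws hv hw (h.trans h'.symm)
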